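/- Let H be a quasiconvex subgroup of a hyperbolic group G with Cayley graph Γ_G, and let L_k = g_kΛ denote the limit set of the coset g_kH, with P_j the nearest point projection of Γ_G onto the join J(L_j) and H_k = g_kΓ_H the corresponding coset of H. Then there exists K > 0 such that for all i, j with g_iH ≠ g_jH: if L_i ∩ L_j ≠ ∅, then P_j(Γ_{H_i}) lies in the K-neighborhood of J(L_i ∩ L_j); otherwise P_j(Γ_{H_i}) has diameter less than K. -/

import Mathlib

/-!
Common coarse-geometric definitions used to formalize statements from
"Relative Rigidity, Quasiconvexity and C-Complexes" (Mahan Mj).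

We model the Cayley graph of a finitely generated group by the group itself
equipped with a word metric (the vertex set of the Cayley graph, with
bi-infinite geodesics modelled by `ℤ`-parametrized discrete geodesics), and we
set up all basic notions (Gromov products, hyperbolicity, the Gromov boundary
via Gromov sequences, limit sets, joins, quasiconvexity, electric metrics and
relative hyperbolicity à la Farb, uniformly proper maps, quasi-isometries)
relative to an abstract distance function `d : α → α → ℝ`.
-/

open Filter Set Metric
open scoped ENNReal

noncomputable section

namespace RelRig

universe u v

variable {α β : Type*}

/-- Gromov product of `x`, `y` based at `w`. -/
def gpD (d : α → α → ℝ) (w x y : α) : ℝ := (d w x + d w y - d x y) / 2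

/-- `d` satisfies the Gromov four-point condition with constant `δ`. -/
def DeltaHypD (d : α → α → ℝ) (δ : ℝ) : Prop :=
  ∀ w x y z : α, min (gpD d w x y) (gpD d w y z) - δ ≤ gpD d w x z

/-- `d` is Gromov-hyperbolic. -/
def HypD (d : α → α → ℝ) : Prop := ∃ δ ≥ (0 : ℝ), DeltaHypD d δ

/-- distance from a point to a set. -/
def pdistD (d : α → α → ℝ) (x : α) (A : Set α) : ℝ := sInf {r | ∃ a ∈ A, r = d x a}

/-- (infimal) distance between two sets. -/
def setDistD (d : α → α → ℝ) (A B : Set α) : ℝ := sInf {r | ∃ a ∈ A, ∃ b ∈ B, r = d a b}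

/-- closed `r`-neighbourhood of a set. -/
def nbdD (d : α → α → ℝ) (r : ℝ) (A : Set α) : Set α := {x | ∃ a ∈ A, d x a ≤ r}

/-- a sequence going to infinity (a "Gromov sequence"). -/
def GromovSeqD (d : α → α → ℝ) (w : α) (s : ℕ → α) : Prop :=
  Tendsto (fun p : ℕ × ℕ => gpD d w (s p.1) (s p.2)) atTop atTop

/-- asymptoticity of Gromov sequences. -/
def bdryRelD (d : α → α → ℝ) (w : α) (s t : {u : ℕ → α // GromovSeqD d w u}) : Prop :=
  Tendsto (fun p : ℕ × ℕ => gpD d w (s.1 p.1) (t.1 p.2)) atTop atTop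

/-- The Gromov boundary of `(α, d)`: asymptoticity classes of Gromov sequences. -/
def BdryD (d : α → α → ℝ) (w : α) := Quot (bdryRelD d w)

/-- `s` converges to the boundary point `ξ`. -/
def ConvTo (d : α → α → ℝ) (w : α) (s : ℕ → α) (ξ : BdryD d w) : Prop :=
  ∃ hs : GromovSeqD d w s, Quot.mk (bdryRelD d w) ⟨s, hs⟩ = ξ

/-- the limit set of a subset `A ⊆ α` in the Gromov boundary. -/
def limitSetD (d : α → α → ℝ) (w : α) (A : Set α) : Set (BdryD d w) :=
  {ξ | ∃ s : ℕ → α, (∀ n, s n ∈ A) ∧ ConvTo d w s ξ}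

/-- Gromov product of two boundary points. -/
def bgpD (d : α → α → ℝ) (w : α) (ξ η : BdryD d w) : ℝ≥0∞ :=
  ⨆ s : {s : ℕ → α // ConvTo d w s ξ}, ⨆ t : {t : ℕ → α // ConvTo d w t η},
    Filter.liminf (fun p : ℕ × ℕ => ENNReal.ofReal (gpD d w (s.1 p.1) (t.1 p.2))) atTop

open Classical in
/-- the visual (quasi-)metric on the boundary. -/
def vdistD (d : α → α → ℝ) (w : α) (ξ η : BdryD d w) : ℝ :=
  if ξ = η then 0 else Real.exp (-(bgpD d w ξ η).toReal)

/-- visual diameter of a subset of the boundary. -/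
def vdiamD (d : α → α → ℝ) (w : α) (Λ : Set (BdryD d w)) : ℝ :=
  sSup {r | ∃ ξ ∈ Λ, ∃ η ∈ Λ, r = vdistD d w ξ η}

/-- Hausdorff distance between two subsets of the boundary (visual metric). -/
def vHdistD (d : α → α → ℝ) (w : α) (A B : Set (BdryD d w)) : ℝ :=
  max (sSup {r | ∃ a ∈ A, r = sInf {t | ∃ b ∈ B, t = vdistD d w a b}})
      (sSup {r | ∃ b ∈ B, r = sInf {t | ∃ a ∈ A, t = vdistD d w a b}})

/-- closed subsets of the boundary w.r.t. the visual metric. -/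
def VClosed (d : α → α → ℝ) (w : α) (K : Set (BdryD d w)) : Prop :=
  ∀ ξ : BdryD d w, (∀ ε > (0 : ℝ), ∃ η ∈ K, vdistD d w ξ η < ε) → ξ ∈ K

/-- A family (multiset) of boundary subsets is a discrete subset of `C_c⁰(∂X)`,
the space of closed subsets of the boundary having more than one point, with the
Hausdorff topology: the family does not accumulate (with multiplicity) at any
closed subset of the boundary having more than one point. -/
def DiscreteFamilyD {ι : Type*} (d : α → α → ℝ) (w : α) (L : ι → Set (BdryD d w)) : Prop :=
  ∀ K : Set (BdryD d w), VClosed d w K → K.Nontrivial →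
    ¬ (∀ ε > (0 : ℝ), {i : ι | vHdistD d w (L i) K < ε}.Infinite)

/-- discrete geodesic of length `m` (suitable for graphs/word metrics). -/
def DiscGeodD (d : α → α → ℝ) (c : ℕ → α) (m : ℕ) : Prop :=
  ∀ i, i ≤ m → ∀ j, j ≤ m → d (c i) (c j) = |(i : ℝ) - (j : ℝ)|

/-- discrete bi-infinite geodesic. -/
def DiscLineD (d : α → α → ℝ) (γ : ℤ → α) : Prop :=
  ∀ i j : ℤ, d (γ i) (γ j) = |(i : ℝ) - (j : ℝ)|

/-- `A` is a `K`-quasiconvex subset: every (discrete) geodesic with endpoints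
in `A` stays in the `K`-neighbourhood of `A`. -/
def QCSetD (d : α → α → ℝ) (K : ℝ) (A : Set α) : Prop :=
  ∀ (c : ℕ → α) (m : ℕ), DiscGeodD d c m → c 0 ∈ A → c m ∈ A →
    ∀ i, i ≤ m → pdistD d (c i) A ≤ K

/-- both endpoints of the bi-infinite geodesic `γ` lie in `Λ`. -/
def LineEndsInD (d : α → α → ℝ) (w : α) (γ : ℤ → α) (Λ : Set (BdryD d w)) : Prop :=
  (∃ ξ ∈ Λ, ConvTo d w (fun n : ℕ => γ (n : ℤ)) ξ) ∧
  (∃ η ∈ Λ, ConvTo d w (fun n : ℕ => γ (-(n : ℤ))) η)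

/-- the join `J(Λ)`: the union of all bi-infinite geodesics with both endpoints in `Λ`. -/
def joinD (d : α → α → ℝ) (w : α) (Λ : Set (BdryD d w)) : Set α :=
  {p | ∃ γ : ℤ → α, DiscLineD d γ ∧ LineEndsInD d w γ Λ ∧ p ∈ Set.range γ}

/-- a nearest-point projection onto `A`. -/
def IsNearestProjD (d : α → α → ℝ) (A : Set α) (P : α → α) : Prop :=
  ∀ x : α, P x ∈ A ∧ ∀ a ∈ A, d x (P x) ≤ d x a

/-- uniformly proper pairing of two collections of subsets (Schwarz, Mj). -/
def UProperD {ι κ : Type*} (d₁ : α → α → ℝ) (d₂ : β → β → ℝ)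
    (J₁ : ι → Set α) (J₂ : κ → Set β) (φ : ι → κ) : Prop :=
  ∃ f : ℕ → ℕ, ∀ (n : ℕ) (i i' : ι),
    (setDistD d₁ (J₁ i) (J₁ i') ≤ (n : ℝ) →
      setDistD d₂ (J₂ (φ i)) (J₂ (φ i')) ≤ (f n : ℝ)) ∧
    (setDistD d₂ (J₂ (φ i)) (J₂ (φ i')) ≤ (n : ℝ) →
      setDistD d₁ (J₁ i) (J₁ i') ≤ (f n : ℝ))

/-- `q` pairs the collections `J₁`, `J₂` as `φ` does. -/
def PairsAsD {ι κ : Type*} (d₁ : α → α → ℝ) (d₂ : β → β → ℝ)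
    (q : α → β) (J₁ : ι → Set α) (J₂ : κ → Set β) (φ : ι → κ) : Prop :=
  ∃ h : ℕ → ℕ, ∀ (n : ℕ) (p : α) (i : ι),
    pdistD d₁ p (J₁ i) ≤ (n : ℝ) → pdistD d₂ (q p) (J₂ (φ i)) ≤ (h n : ℝ)

/-- quasi-isometry between `(α, d₁)` and `(β, d₂)`. -/
def QIMapD (d₁ : α → α → ℝ) (d₂ : β → β → ℝ) (q : α → β) : Prop :=
  ∃ lam C : ℝ, 1 ≤ lam ∧ 0 ≤ C ∧
    (∀ x y : α, d₂ (q x) (q y) ≤ lam * d₁ x y + C ∧ d₁ x y ≤ lam * d₂ (q x) (q y) + C) ∧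
    (∀ z : β, ∃ x : α, d₂ z (q x) ≤ C)

/-! ### Word metrics, quasiconvex subgroups, limit sets of cosets -/

section Groups
variable {G : Type*} [Group G]

/-- the word metric associated to a (symmetrized) generating set `S`. -/
def wdist (S : Set G) (g h : G) : ℝ :=
  sInf {r | ∃ l : List G, (∀ x ∈ l, x ∈ S ∨ x⁻¹ ∈ S) ∧ l.prod = g⁻¹ * h ∧ r = (l.length : ℝ)}

/-- the left coset `gH` as a subset of `G`. -/
def cosetSet (H : Subgroup G) (g : G) : Set G := {x | g⁻¹ * x ∈ H}

/-- `R` contains exactly one representative of each left coset of `H`. -/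
def IsCosetReps (H : Subgroup G) (R : Set G) : Prop :=
  ∀ g : G, ∃! r : G, r ∈ R ∧ g⁻¹ * r ∈ H

/-- the translate `gΛ(H)` of the limit set of `H` in the Gromov boundary:
the limit set of the coset `gH`. -/
def cosetLimitSet (S : Set G) (H : Subgroup G) (g : G) : Set (BdryD (wdist S) (1 : G)) :=
  limitSetD (wdist S) 1 (cosetSet H g)

/-- the join `J(gΛ(H))` of the translate `gΛ(H)` of the limit set of `H`. -/
def cosetJoin (S : Set G) (H : Subgroup G) (g : G) : Set G :=
  joinD (wdist S) 1 (cosetLimitSet S H g)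

/-- quasiconvex subgroup w.r.t. the word metric of `S`. -/
def QCSubgroup (S : Set G) (H : Subgroup G) : Prop :=
  ∃ C ≥ (0 : ℝ), QCSetD (wdist S) C (H : Set G)

/-- malnormal subgroup: `gHg⁻¹ ∩ H` is trivial for `g ∉ H`. -/
def Malnormal (H : Subgroup G) : Prop :=
  ∀ g : G, g ∉ H → ∀ x : G, x ∈ H → g * x * g⁻¹ ∈ H → x = 1

end Groups

/-! ### Relative hyperbolicity (Farb: electric space + bounded penetration) -/

section RelHyp
variable {α : Type*}

open Classical in
/-- cost of one step of an electric chain: travelling within a horosphere-like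
set costs at most `1` (passing through the cone point). -/
def stepCost (d : α → α → ℝ) (ℋ : Set (Set α)) (a b : α) : ℝ :=
  if ∃ H ∈ ℋ, a ∈ H ∧ b ∈ H then min 1 (d a b) else d a b

/-- electric length of the portion `[i, j]` of a chain. -/
def chainLen (d : α → α → ℝ) (ℋ : Set (Set α)) (p : ℕ → α) (i j : ℕ) : ℝ :=
  ∑ k ∈ Finset.Ico i j, stepCost d ℋ (p k) (p (k + 1))

/-- the electric (coned-off) pseudo-metric of Farb's electric space. -/
def elDist (d : α → α → ℝ) (ℋ : Set (Set α)) (x y : α) : ℝ :=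
  sInf {r | ∃ (n : ℕ) (p : ℕ → α), p 0 = x ∧ p n = y ∧ r = chainLen d ℋ p 0 n}

/-- weak relative hyperbolicity: the electric space is hyperbolic. -/
def WeakRelHyp (d : α → α → ℝ) (ℋ : Set (Set α)) : Prop := HypD (elDist d ℋ)

/-- an electric `P`-quasigeodesic chain. -/
def ElQG (d : α → α → ℝ) (ℋ : Set (Set α)) (P : ℝ) (p : ℕ → α) (n : ℕ) : Prop :=
  ∀ i j : ℕ, i ≤ j → j ≤ n → chainLen d ℋ p i j ≤ P * elDist d ℋ (p i) (p j) + P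

/-- the chain does not return to the `ε`-neighbourhood of any horosphere-like
set after leaving it. -/
def NoBacktrack (d : α → α → ℝ) (ℋ : Set (Set α)) (ε : ℝ) (p : ℕ → α) (n : ℕ) : Prop :=
  ∀ H ∈ ℋ, ∀ i j k : ℕ, i < j → j < k → k ≤ n →
    p i ∈ nbdD d ε H → p k ∈ nbdD d ε H → p j ∈ nbdD d ε H

/-- the chain meets `S`. -/
def MeetsChain (p : ℕ → α) (n : ℕ) (S : Set α) : Prop := ∃ i ≤ n, p i ∈ S

/-- `i` is the entry point of the chain into the `ε`-neighbourhood of `H`. -/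
def IsEntry (d : α → α → ℝ) (ε : ℝ) (H : Set α) (p : ℕ → α) (n i : ℕ) : Prop :=
  i ≤ n ∧ p i ∈ nbdD d ε H ∧ ∀ j, j < i → p j ∉ nbdD d ε H

/-- `i` is the exit point of the chain from the `ε`-neighbourhood of `H`. -/
def IsExit (d : α → α → ℝ) (ε : ℝ) (H : Set α) (p : ℕ → α) (n i : ℕ) : Prop :=
  i ≤ n ∧ p i ∈ nbdD d ε H ∧ ∀ j, i < j → j ≤ n → p j ∉ nbdD d ε H

/-- coarse intrinsic path-metric of a subset `S`. -/
def inDist (d : α → α → ℝ) (S : Set α) (x y : α) : ℝ :=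
  sInf {r | ∃ (n : ℕ) (p : ℕ → α), p 0 = x ∧ p n = y ∧ (∀ i, i ≤ n → p i ∈ S) ∧
    (∀ i, i < n → d (p i) (p (i + 1)) ≤ 1) ∧
    r = ∑ k ∈ Finset.range n, d (p k) (p (k + 1))}

/-- Bounded penetration: electric quasigeodesics without backtracking with the
same endpoints have similar intersection patterns with horosphere-like sets. -/
def BddPenetration (d : α → α → ℝ) (ℋ : Set (Set α)) : Prop :=
  ∀ P ≥ (1 : ℝ), ∃ ε ≥ (0 : ℝ), ∃ D ≥ (0 : ℝ),
    ∀ (p q : ℕ → α) (n m : ℕ), p 0 = q 0 → p n = q m →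
      ElQG d ℋ P p n → ElQG d ℋ P q m →
      NoBacktrack d ℋ ε p n → NoBacktrack d ℋ ε q m →
      ∀ H ∈ ℋ,
        (¬ MeetsChain q m (nbdD d ε H) →
          ∀ i j, IsEntry d ε H p n i → IsExit d ε H p n j →
            inDist d (nbdD d ε H) (p i) (p j) ≤ D) ∧
        (MeetsChain q m (nbdD d ε H) →
          (∀ i j, IsEntry d ε H p n i → IsEntry d ε H q m j →
            inDist d (nbdD d ε H) (p i) (q j) ≤ D) ∧
          (∀ i j, IsExit d ε H p n i → IsExit d ε H q m j →
            inDist d (nbdD d ε H) (p i) (q j) ≤ D))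

/-- the collection `ℋ` is uniformly separated. -/
def UnifSeparated (d : α → α → ℝ) (ℋ : Set (Set α)) : Prop :=
  ∃ ε > (0 : ℝ), ∀ H₁ ∈ ℋ, ∀ H₂ ∈ ℋ, H₁ ≠ H₂ → ε ≤ setDistD d H₁ H₂

/-- strong relative hyperbolicity (Farb's definition; equivalent to Gromov's
definition via hyperbolic cones, by Bowditch). -/
def StrongRelHyp (d : α → α → ℝ) (ℋ : Set (Set α)) : Prop :=
  UnifSeparated d ℋ ∧ WeakRelHyp d ℋ ∧ BddPenetration d ℋ

end RelHyp

/-! ### Geodesic metric spaces, CAT(0) spaces, flats, symmetric spaces -/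

section MetricGeo
variable {X : Type*} [MetricSpace X]

/-- `γ` is a unit-speed parametrization of a geodesic from `x` to `y`. -/
def GeodParam (γ : ℝ → X) (x y : X) : Prop :=
  γ 0 = x ∧ γ (dist x y) = y ∧
    ∀ s ∈ Icc (0 : ℝ) (dist x y), ∀ t ∈ Icc (0 : ℝ) (dist x y), dist (γ s) (γ t) = |s - t|

/-- `s` is (the image of) a geodesic segment from `x` to `y`. -/
def IsGeodSeg (x y : X) (s : Set X) : Prop :=
  ∃ γ : ℝ → X, GeodParam γ x y ∧ s = γ '' Icc (0 : ℝ) (dist x y)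

/-- geodesic metric space. -/
def GeodesicSpace (X : Type*) [MetricSpace X] : Prop := ∀ x y : X, ∃ s : Set X, IsGeodSeg x y s

/-- `A` is a `K`-quasiconvex subset of the metric space `X`. -/
def QCSet (K : ℝ) (A : Set X) : Prop :=
  ∀ x ∈ A, ∀ y ∈ A, ∀ s : Set X, IsGeodSeg x y s → ∀ p ∈ s, Metric.infDist p A ≤ K

/-- `γ` is a bi-infinite (unit-speed) geodesic. -/
def IsGeodLine (γ : ℝ → X) : Prop := ∀ a b : ℝ, dist (γ a) (γ b) = |a - b|

/-- both endpoints of the geodesic line `γ` lie in `Λ`. -/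
def lineEndsIn (w : X) (γ : ℝ → X) (Λ : Set (BdryD (fun x y : X => dist x y) w)) : Prop :=
  (∃ ξ ∈ Λ, ConvTo (fun x y : X => dist x y) w (fun n : ℕ => γ (n : ℝ)) ξ) ∧
  (∃ η ∈ Λ, ConvTo (fun x y : X => dist x y) w (fun n : ℕ => γ (-(n : ℝ))) η)

/-- the join of `Λ ⊆ ∂X`: the union of bi-infinite geodesics with endpoints in `Λ`. -/
def joinR (w : X) (Λ : Set (BdryD (fun x y : X => dist x y) w)) : Set X :=
  {p | ∃ γ : ℝ → X, IsGeodLine γ ∧ lineEndsIn w γ Λ ∧ p ∈ Set.range γ}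

/-- CAT(0) space, via the CN (Bruhat–Tits) midpoint inequality. -/
def CAT0 (X : Type*) [MetricSpace X] : Prop :=
  GeodesicSpace X ∧ ∀ x y z m : X, dist y m = dist y z / 2 → dist z m = dist y z / 2 →
    dist x m ^ 2 ≤ (dist x y ^ 2 + dist x z ^ 2) / 2 - dist y z ^ 2 / 4

/-- a `k`-flat: an isometrically embedded copy of Euclidean `k`-space. -/
def FlatOfDim (k : ℕ) (F : Set X) : Prop :=
  ∃ f : EuclideanSpace ℝ (Fin k) → X, Isometry f ∧ Set.range f = F

/-- a flat (of dimension at least 2). -/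
def IsFlat2 (F : Set X) : Prop := ∃ k : ℕ, 2 ≤ k ∧ FlatOfDim k F

/-- a maximal flat. -/
def IsMaxFlat (F : Set X) : Prop := IsFlat2 F ∧ ∀ F' : Set X, IsFlat2 F' → F ⊆ F' → F' = F

/-- isolated flats: every flat is uniformly close to a maximal one, and
neighbourhoods of distinct maximal flats have uniformly bounded overlap. -/
def IsolatedFlats (X : Type*) [MetricSpace X] : Prop :=
  (∃ D ≥ (0 : ℝ), ∀ F : Set X, IsFlat2 F →
    ∃ F' : Set X, IsMaxFlat F' ∧ ∀ x ∈ F, Metric.infDist x F' ≤ D) ∧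
  (∀ ρ ≥ (0 : ℝ), ∃ κ ≥ (0 : ℝ), ∀ F F' : Set X, IsMaxFlat F → IsMaxFlat F' → F ≠ F' →
    ∀ x y : X, Metric.infDist x F ≤ ρ → Metric.infDist x F' ≤ ρ →
      Metric.infDist y F ≤ ρ → Metric.infDist y F' ≤ ρ → dist x y ≤ κ)

/-- a (globally) symmetric space of non-positive curvature: a CAT(0) space with
a geodesic point-symmetry at every point. -/
def SymmSpaceNonpos (X : Type*) [MetricSpace X] : Prop :=
  CAT0 X ∧ ∀ x : X, ∃ σ : X ≃ᵢ X, σ x = x ∧ ∀ y : X, dist y (σ y) = 2 * dist x y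

/-- `X` has rank `r`: it contains an `r`-flat but no `(r+1)`-flat. -/
def HasRank (X : Type*) [MetricSpace X] (r : ℕ) : Prop :=
  (∃ F : Set X, FlatOfDim r F) ∧ ∀ F : Set X, ¬ FlatOfDim (r + 1) F

end MetricGeo

/-! ### Group actions -/

/-- a geometric action: by isometries, metrically proper and cobounded. -/
def GeometricAction (G : Type*) [Group G] (X : Type*) [MetricSpace X] [MulAction G X] : Prop :=
  (∀ g : G, Isometry (fun x : X => g • x)) ∧
  (∀ x₀ : X, ∀ r : ℝ, {g : G | dist x₀ (g • x₀) ≤ r}.Finite) ∧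
  (∀ x₀ : X, ∃ C : ℝ, ∀ x : X, ∃ g : G, dist x (g • x₀) ≤ C)

/-- `𝒥` is the `G`-equivariant family of lifts of a maximal totally geodesic
torus (of dimension `r = rank`) in the compact locally symmetric space `X/G`:
an orbit of a periodic `r`-flat. -/
def TorusLiftFamily (G : Type*) [Group G] {X : Type*} [MetricSpace X] [MulAction G X]
    (r : ℕ) (𝒥 : Set (Set X)) : Prop :=
  (∀ J ∈ 𝒥, FlatOfDim r J) ∧
  (∃ F₀ ∈ 𝒥, 𝒥 = {J : Set X | ∃ g : G, J = (fun x : X => g • x) '' F₀}) ∧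
  (∃ C ≥ (0 : ℝ), ∀ J ∈ 𝒥, ∀ x ∈ J, ∀ y ∈ J,
    ∃ g : G, (fun z : X => g • z) '' J = J ∧ dist x (g • y) ≤ C)

/-! ### Convergence groups, annulus systems and cross-ratios (Bowditch) -/

/-- the space of distinct triples of `M`. -/
def distinctTriples (M : Type*) : Set (M × M × M) :=
  {p | p.1 ≠ p.2.1 ∧ p.1 ≠ p.2.2 ∧ p.2.1 ≠ p.2.2}

/-- the diagonal action on triples. -/
def tripleAct {G M : Type*} [Group G] [MulAction G M] (g : G) (p : M × M × M) : M × M × M :=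
  (g • p.1, g • p.2.1, g • p.2.2)

/-- a uniform convergence group action: the action on the space of distinct
triples is properly discontinuous and cocompact. -/
def UniformConvergenceAction (G : Type*) [Group G] (M : Type*) [TopologicalSpace M]
    [MulAction G M] : Prop :=
  (∀ g : G, Continuous (fun x : M => g • x)) ∧
  (∀ K : Set (M × M × M), K ⊆ distinctTriples M → IsCompact K →
    {g : G | (tripleAct g '' K ∩ K).Nonempty}.Finite) ∧
  (∃ K : Set (M × M × M), K ⊆ distinctTriples M ∧ IsCompact K ∧
    ∀ p ∈ distinctTriples M, ∃ g : G, tripleAct g p ∈ K)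

/-- an (unconstrained) ordered pair of subsets of `M`. -/
structure Ann (M : Type*) where
  minus : Set M
  plus : Set M

/-- `A` is an annulus: an ordered pair of disjoint closed subsets not covering `M`. -/
def IsAnnulusOn (M : Type*) [TopologicalSpace M] (A : Ann M) : Prop :=
  IsClosed A.minus ∧ IsClosed A.plus ∧ Disjoint A.minus A.plus ∧ A.minus ∪ A.plus ≠ Set.univ

/-- translate of an annulus. -/
def annAct {G M : Type*} [Group G] [MulAction G M] (g : G) (A : Ann M) : Ann M :=
  ⟨(fun x : M => g • x) '' A.minus, (fun x : M => g • x) '' A.plus⟩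

/-- a nested chain of `m` annuli of `𝒜` separating `K` from `L`:
`K < A₁ < ⋯ < A_m < L`. -/
def SepChain {M : Type*} [TopologicalSpace M] (𝒜 : Set (Ann M)) (K L : Set M) (m : ℕ) : Prop :=
  m = 0 ∨ ∃ A : ℕ → Ann M, (∀ i, i < m → A i ∈ 𝒜) ∧
    K ⊆ interior (A 0).minus ∧ L ⊆ interior (A (m - 1)).plus ∧
    ∀ i, i + 1 < m → interior (A i).minus ∪ interior (A (i + 1)).plus = Set.univ

/-- the annular cross-ratio `(K|L)_𝒜 ∈ ℕ ∪ {∞}`. -/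
def crossRatioAnn {M : Type*} [TopologicalSpace M] (𝒜 : Set (Ann M)) (K L : Set M) : ℕ∞ :=
  sSup {n : ℕ∞ | ∃ m : ℕ, n = (m : ℕ∞) ∧ SepChain 𝒜 K L m}

/-- the limit set of a subgroup of a convergence group. -/
def convLimitSet {G : Type*} [Group G] {M : Type*} [TopologicalSpace M] [MulAction G M]
    (H : Subgroup G) : Set M :=
  {ξ : M | ∃ h : ℕ → H, Function.Injective h ∧
    ∃ x : M, Tendsto (fun n => (h n : G) • x) atTop (nhds ξ)}

/-- discreteness of a family (multiset) of subsets of a metrizable compactum `M`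
in the Hausdorff topology on the space of closed subsets of `M` with more than
one point. -/
def DiscreteFamilyM {ι M : Type*} [MetricSpace M] (L : ι → Set M) : Prop :=
  ∀ K : Set M, IsClosed K → K.Nontrivial →
    ¬ (∀ ε > (0 : ℝ), {i : ι | Metric.hausdorffDist (L i) K < ε}.Infinite)

/-- uniform properness of a pairing with respect to annular cross-ratios. -/
def UProperCRFam {ι κ M₁ M₂ : Type*} [TopologicalSpace M₁] [TopologicalSpace M₂]
    (𝒜₁ : Set (Ann M₁)) (𝒜₂ : Set (Ann M₂))
    (L₁ : ι → Set M₁) (L₂ : κ → Set M₂) (φ : ι → κ) : Prop :=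
  ∃ f : ℕ → ℕ, ∀ (n : ℕ) (i i' : ι),
    (crossRatioAnn 𝒜₁ (L₁ i) (L₁ i') ≤ (n : ℕ∞) →
      crossRatioAnn 𝒜₂ (L₂ (φ i)) (L₂ (φ i')) ≤ (f n : ℕ∞)) ∧
    (crossRatioAnn 𝒜₂ (L₂ (φ i)) (L₂ (φ i')) ≤ (n : ℕ∞) →
      crossRatioAnn 𝒜₁ (L₁ i) (L₁ i') ≤ (f n : ℕ∞))

/-! ### Auxiliary lemmas for the proof -/

/-- a geodesic hyperbolic metric (discrete version). -/
structure HM (d : α → α → ℝ) (δ : ℝ) : Prop where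
  self : ∀ x, d x x = 0
  symm : ∀ x y, d x y = d y x
  tri : ∀ x y z, d x z ≤ d x y + d y z
  nonneg : ∀ x y, 0 ≤ d x y
  hyp : DeltaHypD d δ
  geod : ∀ x y, ∃ (c : ℕ → α) (m : ℕ), DiscGeodD d c m ∧ c 0 = x ∧ c m = y

/-- quasiconvexity phrased through Gromov products. -/
def GQC (d : α → α → ℝ) (σ : ℝ) (A : Set α) : Prop :=
  ∀ x ∈ A, ∀ y ∈ A, ∀ w, ∃ a ∈ A, d w a ≤ gpD d w x y + σ

/-- asymptotic sequences. -/
def Asy (d : α → α → ℝ) (w : α) (s t : ℕ → α) : Prop :=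
  Tendsto (fun p : ℕ × ℕ => gpD d w (s p.1) (t p.2)) atTop atTop

lemma asy_iff (d : α → α → ℝ) (w : α) (s t : ℕ → α) :
    Asy d w s t ↔ ∀ M : ℝ, ∃ N : ℕ, ∀ n ≥ N, ∀ m ≥ N, M ≤ gpD d w (s n) (t m) := by
  unfold Asy
  rw [tendsto_atTop_atTop]
  constructor
  · intro h M
    obtain ⟨⟨a, b⟩, hab⟩ := h M
    refine ⟨max a b, fun n hn m hm => hab (n, m) ?_⟩
    exact Prod.mk_le_mk.2 ⟨le_trans (le_max_left _ _) hn, le_trans (le_max_right _ _) hm⟩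
  · intro h M
    obtain ⟨N, hN⟩ := h M
    refine ⟨(N, N), fun a ha => hN _ ha.1 _ ha.2⟩

section abstractHM
variable {d : α → α → ℝ} {δ : ℝ}

lemma HM.four (h : HM d δ) (w x y z : α) :
    d w z + d x y ≤ max (d w x + d z y) (d w y + d z x) + 2 * δ := by
  have h1 := h.hyp x w y z
  have h2 := h.hyp y w x z
  have h3 := h.hyp w x z y
  have e1 := h.symm x y
  have e2 := h.symm w z
  have e3 := h.symm w x
  have e4 := h.symm w y
  have e5 := h.symm z x
  have e6 := h.symm z y
  unfold gpD at *
  rcases le_total (d w x + d z y) (d w y + d z x) with hc | hc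
  · rw [max_eq_right hc]
    rcases min_choice ((d w x + d w z - d x z) / 2) ((d w z + d w y - d z y) / 2) with hm | hm <;>
      rw [hm] at h3 <;> linarith
  · rw [max_eq_left hc]
    rcases min_choice ((d w x + d w z - d x z) / 2) ((d w z + d w y - d z y) / 2) with hm | hm <;>
      rw [hm] at h3 <;> linarith

lemma HM.gp_comm (h : HM d δ) (w x y : α) : gpD d w x y = gpD d w y x := by
  unfold gpD; rw [h.symm x y]; ring

lemma HM.gp_base (h : HM d δ) (w w' x y : α) : gpD d w x y ≤ gpD d w' x y + d w w' := by
  have := h.tri w w' x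
  have := h.tri w w' y
  unfold gpD; linarith

lemma HM.gp_right (h : HM d δ) (w x y y' : α) : gpD d w x y ≤ gpD d w x y' + d y y' := by
  have := h.tri w y' y
  have := h.tri x y y'
  have := h.symm y y'
  unfold gpD; linarith

lemma HM.gp_left (h : HM d δ) (w x y x' : α) : gpD d w x y ≤ gpD d w x' y + d x x' := by
  rw [h.gp_comm w x y, h.gp_comm w x' y]; exact h.gp_right _ _ _ _

lemma HM.gp_nonneg (h : HM d δ) (w x y : α) : 0 ≤ gpD d w x y := by
  have := h.tri x w y
  have := h.symm x w
  unfold gpD; linarith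

lemma HM.gp_le (h : HM d δ) (w x y : α) : gpD d w x y ≤ d w x := by
  have := h.tri w x y
  unfold gpD; linarith

/-- a point on a geodesic from `x` to `y` at prescribed distance -/
lemma HM.near {c : ℕ → α} {m : ℕ} (h : HM d δ) (hc : DiscGeodD d c m) (w : α) :
    ∃ i, i ≤ m ∧ d w (c i) ≤ gpD d w (c 0) (c m) + 2 * δ + 1 ∧
      gpD d (c 0) w (c m) - 1 ≤ d (c 0) (c i) ∧ d (c 0) (c i) ≤ gpD d (c 0) w (c m) ∧
      d (c 0) (c i) + d (c i) (c m) = d (c 0) (c m) := by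
  have hm : d (c 0) (c m) = m := by
    rw [hc 0 (Nat.zero_le _) m le_rfl]; simp
  have h0 := h.gp_nonneg (c 0) w (c m)
  have h1 := h.gp_le (c 0) (c m) w
  rw [h.gp_comm, hm] at h1
  set t := ⌊gpD d (c 0) w (c m)⌋₊ with ht
  have htm : t ≤ m := by
    have : (t : ℝ) ≤ m := le_trans (Nat.floor_le h0) h1
    exact_mod_cast this
  have hl : (t : ℝ) ≤ gpD d (c 0) w (c m) := Nat.floor_le h0
  have hu : gpD d (c 0) w (c m) < t + 1 := Nat.lt_floor_add_one _
  have ha : d (c 0) (c t) = t := by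
    rw [hc 0 (Nat.zero_le _) t htm]; simp
  have hb : d (c t) (c m) = m - t := by
    rw [hc t htm m le_rfl, abs_sub_comm, abs_of_nonneg]
    have : (t : ℝ) ≤ m := by exact_mod_cast htm
    linarith
  refine ⟨t, htm, ?_, by linarith, by linarith, by linarith⟩
  have hf := h.four w (c 0) (c m) (c t)
  have e1 := h.symm (c t) (c 0)
  have e2 := h.symm (c 0) w
  have e3 := h.symm (c m) w
  have e4 := h.symm (c t) (c m)
  unfold gpD at *
  rcases max_choice (d w (c 0) + d (c t) (c m)) (d w (c m) + d (c t) (c 0)) with hx | hx <;>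
    rw [hx] at hf <;> linarith

lemma HM.gqc (h : HM d δ) {C : ℝ} {A : Set α} (hA : QCSetD d C A) :
    GQC d (C + 2 * δ + 2) A := by
  intro x hx y hy w
  obtain ⟨c, m, hc, rfl, rfl⟩ := h.geod x y
  obtain ⟨i, hi, h1, -⟩ := h.near hc w
  have h2 := hA c m hc hx hy i hi
  unfold pdistD at h2
  have h3 : sInf {r | ∃ a ∈ A, r = d (c i) a} < C + 1 := by linarith
  obtain ⟨r, ⟨a, ha, rfl⟩, hr⟩ := exists_lt_of_csInf_lt (⟨d (c i) (c 0), c 0, hx, rfl⟩ :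
    {r | ∃ a ∈ A, r = d (c i) a}.Nonempty) h3
  refine ⟨a, ha, ?_⟩
  have := h.tri w (c i) a
  linarith

lemma HM.gqc_close (h : HM d δ) {σ R : ℝ} {A B : Set α} (hA : GQC d σ A)
    (hBA : ∀ b ∈ B, ∃ a ∈ A, d b a ≤ R) (hAB : ∀ a ∈ A, ∃ b ∈ B, d a b ≤ R) :
    GQC d (σ + 3 * R) B := by
  intro x hx y hy w
  obtain ⟨x', hx', h1⟩ := hBA x hx
  obtain ⟨y', hy', h2⟩ := hBA y hy
  obtain ⟨a, ha, h3⟩ := hA x' hx' y' hy' w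
  obtain ⟨b, hb, h4⟩ := hAB a ha
  refine ⟨b, hb, ?_⟩
  have := h.tri w a b
  have := h.gp_left w x' y' x
  have := h.gp_right w x y' y
  have := h.symm x x'
  have := h.symm y y'
  linarith

/-- Gromov products at the nearest point are bounded. -/
lemma HM.proj (h : HM d δ) {σ : ℝ} {J : Set α} (hJ : GQC d σ J) {P : α → α}
    (hP : IsNearestProjD d J P) (x q : α) (hq : q ∈ J) :
    gpD d (P x) x q ≤ δ + σ + 1 := by
  obtain ⟨c, m, hc, h0, hm⟩ := h.geod (P x) x
  obtain ⟨i, hi, h1, h2, h3, h4⟩ := h.near hc q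
  rw [h0, hm] at *
  set z := c i
  obtain ⟨a, ha, h5⟩ := hJ (P x) (hP x).1 q hq z
  have h6 := (hP x).2 a ha
  have h7 := h.tri x z a
  have e1 := h.symm x (P x)
  have e2 := h.symm z x
  have e3 := h.symm z (P x)
  have e4 := h.symm x q
  have e5 := h.symm z q
  have e6 := h.symm q (P x)
  have hf := h.four q (P x) x z
  unfold gpD at *
  rcases max_choice (d q (P x) + d z x) (d q x + d z (P x)) with hx | hx <;>
    rw [hx] at hf <;> linarith

lemma HM.proj_near (h : HM d δ) (hδ : 0 ≤ δ) {σ τ : ℝ} (hτ : 0 ≤ τ)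
    {A J : Set α} (hA : GQC d σ A) (hJ : GQC d τ J)
    {P : α → α} (hP : IsNearestProjD d J P) {x y : α} (hx : x ∈ A) (hy : y ∈ A)
    (hxy : 2 * (δ + τ + 1) + δ < d (P x) (P y)) :
    ∃ a ∈ A, d (P x) a ≤ 2 * δ + τ + 1 + σ := by
  obtain ⟨a, ha, h1⟩ := hA x hx y hy (P x)
  refine ⟨a, ha, ?_⟩
  have h2 := h.proj hJ hP x (P y) (hP y).1
  have h3 := h.proj hJ hP y (P x) (hP x).1
  have h4 := h.hyp (P x) x y (P y)
  have h5 : gpD d (P x) y (P y) = d (P x) (P y) - gpD d (P y) y (P x) := by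
    unfold gpD
    rw [h.symm (P y) y, h.symm (P y) (P x), h.symm y (P x)]; ring
  rcases min_choice (gpD d (P x) x y) (gpD d (P x) y (P y)) with hm | hm <;>
    rw [hm] at h4 <;> linarith

lemma HM.asy_symm (h : HM d δ) {w : α} {s t : ℕ → α} (hs : Asy d w s t) : Asy d w t s := by
  rw [asy_iff] at *
  intro M
  obtain ⟨N, hN⟩ := hs M
  exact ⟨N, fun n hn m hm => by rw [h.gp_comm]; exact hN m hm n hn⟩

lemma HM.asy_trans (h : HM d δ) {w : α} {r s t : ℕ → α} (h1 : Asy d w r s) (h2 : Asy d w s t) :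
    Asy d w r t := by
  rw [asy_iff] at *
  intro M
  obtain ⟨N, hN⟩ := h1 (M + δ)
  obtain ⟨N', hN'⟩ := h2 (M + δ)
  refine ⟨max N N', fun n hn m hm => ?_⟩
  have a1 := hN n (le_trans (le_max_left _ _) hn) (max N N') (le_max_left _ _)
  have a2 := hN' (max N N') (le_max_right _ _) m (le_trans (le_max_right _ _) hm)
  have := h.hyp w (r n) (s (max N N')) (t m)
  have := le_min a1 a2
  linarith

lemma HM.asy_base (h : HM d δ) {w : α} (w' : α) {s t : ℕ → α} (h1 : Asy d w s t) :
    Asy d w' s t := by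
  rw [asy_iff] at *
  intro M
  obtain ⟨N, hN⟩ := h1 (M + d w w')
  refine ⟨N, fun n hn m hm => ?_⟩
  have := hN n hn m hm
  have := h.gp_base w w' (s n) (t m)
  linarith

lemma HM.asy_close (h : HM d δ) {w : α} {s s' t t' : ℕ → α} {R : ℝ} (h1 : Asy d w s t)
    (hs : ∀ n, d (s n) (s' n) ≤ R) (ht : ∀ n, d (t n) (t' n) ≤ R) : Asy d w s' t' := by
  rw [asy_iff] at *
  intro M
  obtain ⟨N, hN⟩ := h1 (M + 2 * R)
  refine ⟨N, fun n hn m hm => ?_⟩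
  have := hN n hn m hm
  have := h.gp_left w (s n) (t m) (s' n)
  have := h.gp_right w (s' n) (t m) (t' m)
  have := hs n
  have := ht m
  linarith

lemma HM.quot (h : HM d δ) {w : α} {s t : ℕ → α} (hs : GromovSeqD d w s) (ht : GromovSeqD d w t)
    (he : Quot.mk (bdryRelD d w) ⟨s, hs⟩ = Quot.mk (bdryRelD d w) ⟨t, ht⟩) : Asy d w s t := by
  have heq : Equivalence (bdryRelD d w) :=
    ⟨fun x => x.2, fun hx => h.asy_symm hx, fun hx hy => h.asy_trans hx hy⟩
  have := Quot.eqvGen_exact he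
  rw [heq.eqvGen_iff] at this
  exact this

lemma HM.mem_limit (h : HM d δ) {w : α} {c : ℕ → α} (hc : GromovSeqD d w c) (A : Set α) :
    (Quot.mk (bdryRelD d w) ⟨c, hc⟩ : BdryD d w) ∈ limitSetD d w A ↔
      ∃ s : ℕ → α, (∀ n, s n ∈ A) ∧ GromovSeqD d w s ∧ Asy d w s c := by
  constructor
  · rintro ⟨s, hsA, hs, he⟩
    exact ⟨s, hsA, hs, h.quot hs hc he⟩
  · rintro ⟨s, hsA, hs, he⟩
    exact ⟨s, hsA, hs, Quot.sound he⟩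

/-- the sequence `c` converges to a point of `Λ A ∩ Λ B`. -/
def EndIn (d : α → α → ℝ) (w : α) (c : ℕ → α) (A B : Set α) : Prop :=
  GromovSeqD d w c ∧ (∃ s : ℕ → α, (∀ n, s n ∈ A) ∧ GromovSeqD d w s ∧ Asy d w s c) ∧
    (∃ s : ℕ → α, (∀ n, s n ∈ B) ∧ GromovSeqD d w s ∧ Asy d w s c)

lemma HM.endIn_iff (h : HM d δ) {w : α} (c : ℕ → α) (A B : Set α) :
    (∃ ξ ∈ limitSetD d w A ∩ limitSetD d w B, ConvTo d w c ξ) ↔ EndIn d w c A B := by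
  constructor
  · rintro ⟨ξ, ⟨hA, hB⟩, hc, rfl⟩
    exact ⟨hc, (h.mem_limit hc A).1 hA, (h.mem_limit hc B).1 hB⟩
  · rintro ⟨hc, hA, hB⟩
    exact ⟨_, ⟨(h.mem_limit hc A).2 hA, (h.mem_limit hc B).2 hB⟩, hc, rfl⟩

lemma HM.inter_nonempty_iff (h : HM d δ) {w : α} (A B : Set α) :
    (limitSetD d w A ∩ limitSetD d w B).Nonempty ↔ ∃ c, EndIn d w c A B := by
  constructor
  · rintro ⟨ξ, hξ⟩
    obtain ⟨⟨c, hc⟩, rfl⟩ := Quot.exists_rep ξ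
    exact ⟨c, (h.endIn_iff c A B).1 ⟨_, hξ, hc, rfl⟩⟩
  · rintro ⟨c, hc⟩
    obtain ⟨ξ, hξ, -⟩ := (h.endIn_iff c A B).2 hc
    exact ⟨ξ, hξ⟩

lemma HM.mem_join_iff (h : HM d δ) {w : α} (A B : Set α) (p : α) :
    p ∈ joinD d w (limitSetD d w A ∩ limitSetD d w B) ↔
      ∃ γ : ℤ → α, DiscLineD d γ ∧ (EndIn d w (fun n : ℕ => γ (n : ℤ)) A B ∧
        EndIn d w (fun n : ℕ => γ (-(n : ℤ))) A B) ∧ p ∈ Set.range γ := by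
  unfold joinD LineEndsInD
  simp only [h.endIn_iff, Set.mem_setOf_eq]

/-- the join of the limit set of a quasiconvex set is close to the set. -/
lemma HM.join_close (h : HM d δ) {w : α} {σ : ℝ} {A : Set α} (hA : GQC d σ A) (p : α)
    (hp : p ∈ joinD d w (limitSetD d w A)) : ∃ a ∈ A, d p a ≤ 2 * δ + σ := by
  rw [← Set.inter_self (limitSetD d w A), h.mem_join_iff] at hp
  obtain ⟨γ, hγ, ⟨⟨-, ⟨s, hsA, -, hs⟩, -⟩, ⟨-, ⟨t, htA, -, ht⟩, -⟩⟩, k, rfl⟩ := hp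
  have hs' := (asy_iff _ _ _ _).1 (h.asy_base (γ k) hs)
  have ht' := (asy_iff _ _ _ _).1 (h.asy_base (γ k) ht)
  obtain ⟨N, hN⟩ := hs' (2 * δ + 1 + |δ|)
  obtain ⟨M, hM⟩ := ht' (2 * δ + 1 + |δ|)
  have hnn := abs_nonneg δ
  have hnn' := le_abs_self δ
  have hnn'' := neg_abs_le δ
  set n := max (max N M) k.natAbs with hn
  have hnN : N ≤ n := le_trans (le_max_left _ _) (le_max_left _ _)
  have hnM : M ≤ n := le_trans (le_max_right _ _) (le_max_left _ _)
  have hnk : k.natAbs ≤ n := le_max_right _ _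
  have hk : |(k : ℝ)| ≤ n := by
    have : |k| ≤ (n : ℤ) := by rw [Int.abs_eq_natAbs]; exact_mod_cast hnk
    exact_mod_cast this
  have hk' := abs_le.1 hk
  obtain ⟨a, ha, h1⟩ := hA (s n) (hsA n) (t n) (htA n) (γ k)
  refine ⟨a, ha, ?_⟩
  have h2 := hN n hnN n hnN
  have h3 := hM n hnM n hnM
  have h4 : gpD d (γ k) (γ n) (γ (-(n : ℤ))) = 0 := by
    unfold gpD
    rw [hγ, hγ, hγ]
    push_cast
    rw [abs_of_nonpos (by linarith), abs_of_nonneg (by linarith), abs_of_nonneg (by linarith)]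
    ring
  have h5 := h.hyp (γ k) (γ n) (s n) (γ (-(n : ℤ)))
  have h6 := h.hyp (γ k) (s n) (t n) (γ (-(n : ℤ)))
  rw [h4, h.gp_comm (γ k) (γ n) (s n)] at h5
  rcases min_choice (gpD d (γ k) (s n) (γ n)) (gpD d (γ k) (s n) (γ (-(n : ℤ)))) with hm | hm <;>
    rw [hm] at h5
  · linarith
  rcases min_choice (gpD d (γ k) (s n) (t n)) (gpD d (γ k) (t n) (γ (-(n : ℤ)))) with hm | hm <;>
    rw [hm] at h6
  · linarith
  · linarith

/-- if the limit sets meet, the projection is unbounded. -/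
lemma HM.proj_unbdd (h : HM d δ) {w : α} {τ R : ℝ} {A B J : Set α} (hJ : GQC d τ J)
    (hBJ : ∀ b ∈ B, ∃ a ∈ J, d b a ≤ R)
    {P : α → α} (hP : IsNearestProjD d J P)
    (hne : (limitSetD d w A ∩ limitSetD d w B).Nonempty) (p : α) (C : ℝ) :
    ∃ y ∈ A, C < d p (P y) := by
  by_contra hcon
  push Not at hcon
  rw [h.inter_nonempty_iff] at hne
  obtain ⟨c, -, ⟨s, hsA, -, hs⟩, ⟨t, htB, -, ht⟩⟩ := hne
  have hst := (asy_iff _ _ _ _).1 (h.asy_base p (h.asy_trans hs (h.asy_symm ht)))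
  obtain ⟨N, hN⟩ := hst (δ + τ + 1 + C + R + 1)
  have h1 := hN N le_rfl N le_rfl
  obtain ⟨a, ha, h2⟩ := hBJ (t N) (htB N)
  have h3 := h.proj hJ hP (s N) a ha
  have h4 := hcon (s N) (hsA N)
  have h5 := h.gp_base p (P (s N)) (s N) (t N)
  have h6 := h.gp_right (P (s N)) (s N) (t N) a
  linarith

/-- a set with infinitely many points yields a Gromov sequence (finite balls). -/
lemma HM.exists_gromov (h : HM d δ) (w : α) (hfin : ∀ r : ℝ, {x | d w x ≤ r}.Finite)
    {X : Set α} (hX : X.Infinite) : ∃ s : ℕ → α, (∀ n, s n ∈ X) ∧ GromovSeqD d w s := by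
  have hfar : ∀ n : ℕ, ∃ x ∈ X, (n : ℝ) < d w x := by
    intro n
    by_contra hcon
    push Not at hcon
    exact hX ((hfin n).subset hcon)
  choose a haX ha using hfar
  choose c m hc h0 hm using fun n => h.geod w (a n)
  have hdm : ∀ n, d w (a n) = m n := by
    intro n
    have := hc n 0 (Nat.zero_le _) (m n) le_rfl
    rw [h0, hm] at this
    rw [this]; simp
  have hnm : ∀ n, n ≤ m n := by
    intro n
    have := ha n
    rw [hdm] at this
    exact_mod_cast this.le
  have hcol : ∀ n r, d w (c n (min r (m n))) ≤ (r : ℝ) := by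
    intro n r
    have := hc n 0 (Nat.zero_le _) (min r (m n)) (min_le_right _ _)
    rw [h0] at this
    rw [this]
    push_cast
    rw [zero_sub, abs_neg, abs_of_nonneg (by positivity)]
    exact min_le_left _ _
  let Y : ℕ → Type _ := fun r => {x // d w x ≤ (r : ℝ)}
  letI : ∀ r, TopologicalSpace (Y r) := fun r => ⊥
  haveI : ∀ r, DiscreteTopology (Y r) := fun r => ⟨rfl⟩
  haveI : ∀ r, Finite (Y r) := fun r => (hfin r).to_subtype
  let f : ℕ → (∀ r, Y r) := fun n r => ⟨c n (min r (m n)), hcol n r⟩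
  obtain ⟨y, φ, hφ, hlim⟩ := CompactSpace.tendsto_subseq f
  rw [tendsto_pi_nhds] at hlim
  refine ⟨a ∘ φ, fun n => haX _, ?_⟩
  refine (asy_iff _ _ _ _).2 fun M => ?_
  set r := ⌈M⌉₊ with hr
  have hev := hlim r
  rw [nhds_discrete, tendsto_pure, eventually_atTop] at hev
  obtain ⟨N, hN⟩ := hev
  have key : ∀ n ≥ max N r, d w (y r).1 = r ∧ d (y r).1 (a (φ n)) = d w (a (φ n)) - r := by
    intro n hn
    have h1 := hN n (le_trans (le_max_left _ _) hn)
    have h2 : (y r).1 = c (φ n) (min r (m (φ n))) := by rw [← h1]; rfl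
    have h3 : r ≤ m (φ n) :=
      le_trans (le_trans (le_trans (le_max_right _ _) hn) (hφ.id_le n)) (hnm _)
    rw [min_eq_left h3] at h2
    constructor
    · have := hc (φ n) 0 (Nat.zero_le _) r h3
      rw [h0] at this
      rw [h2, this]; simp
    · have := hc (φ n) r h3 (m (φ n)) le_rfl
      rw [hm] at this
      rw [h2, this, hdm, abs_sub_comm, abs_of_nonneg]
      have : (r : ℝ) ≤ m (φ n) := by exact_mod_cast h3
      linarith
  refine ⟨max N r, fun n hn k hk => ?_⟩
  obtain ⟨-, h2⟩ := key n hn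
  obtain ⟨-, h3⟩ := key k hk
  have h4 := h.tri (a (φ n)) (y r).1 (a (φ k))
  have h5 := h.symm (a (φ n)) (y r).1
  have h6 : M ≤ r := Nat.le_ceil M
  unfold gpD
  simp only [Function.comp]
  linarith

lemma HM.inter_of_infinite (h : HM d δ) (w : α) (hfin : ∀ r : ℝ, {x | d w x ≤ r}.Finite)
    {R : ℝ} {A B : Set α} (hX : {x | (∃ a ∈ A, d x a ≤ R) ∧ ∃ b ∈ B, d x b ≤ R}.Infinite) :
    (limitSetD d w A ∩ limitSetD d w B).Nonempty := by
  obtain ⟨s, hsX, hs⟩ := h.exists_gromov w hfin hX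
  choose a haA ha using fun n => (hsX n).1
  choose b hbB hb using fun n => (hsX n).2
  have hR : 0 ≤ R := le_trans (h.nonneg _ _) (ha 0)
  have h0 : ∀ n, d (s n) (s n) ≤ R := fun n => by rw [h.self]; exact hR
  rw [h.inter_nonempty_iff]
  exact ⟨s, hs, ⟨a, haA, h.asy_close hs ha ha, h.asy_close hs ha h0⟩,
    ⟨b, hbB, h.asy_close hs hb hb, h.asy_close hs hb h0⟩⟩

end abstractHM

section wordMetric
variable {G : Type*} [Group G] {S : Set G}

lemma wdist_le (S : Set G) {g h : G} (l : List G) (hl : ∀ x ∈ l, x ∈ S ∨ x⁻¹ ∈ S)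
    (hp : l.prod = g⁻¹ * h) : wdist S g h ≤ l.length := by
  refine csInf_le ⟨0, ?_⟩ ⟨l, hl, hp, rfl⟩
  rintro r ⟨l, -, -, rfl⟩
  positivity

lemma wdist_attained (hS : Subgroup.closure S = ⊤) (g h : G) :
    ∃ l : List G, (∀ x ∈ l, x ∈ S ∨ x⁻¹ ∈ S) ∧ l.prod = g⁻¹ * h ∧
      wdist S g h = l.length := by
  classical
  have hex : ∃ n : ℕ, ∃ l : List G, (∀ x ∈ l, x ∈ S ∨ x⁻¹ ∈ S) ∧ l.prod = g⁻¹ * h ∧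
      l.length = n := by
    have : g⁻¹ * h ∈ Subgroup.closure S := by rw [hS]; trivial
    rw [← Subgroup.mem_toSubmonoid, Subgroup.closure_toSubmonoid] at this
    obtain ⟨l, hl, hp⟩ := Submonoid.exists_list_of_mem_closure this
    exact ⟨_, l, hl, hp, rfl⟩
  obtain ⟨l, hl, hp, hn⟩ := Nat.find_spec hex
  refine ⟨l, hl, hp, le_antisymm (wdist_le S l hl hp) ?_⟩
  refine le_csInf ⟨_, l, hl, hp, rfl⟩ ?_
  rintro r ⟨l', hl', hp', rfl⟩
  rw [hn]
  exact_mod_cast Nat.find_min' hex ⟨l', hl', hp', rfl⟩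

lemma wdist_mul (S : Set G) (g x y : G) : wdist S (g * x) (g * y) = wdist S x y := by
  unfold wdist
  have : (g * x)⁻¹ * (g * y) = x⁻¹ * y := by group
  rw [this]

lemma wdist_nonneg (S : Set G) (x y : G) : 0 ≤ wdist S x y := by
  refine Real.sInf_nonneg ?_
  rintro r ⟨l, -, -, rfl⟩
  positivity

lemma wdist_self (S : Set G) (x : G) : wdist S x x = 0 := by
  refine le_antisymm ?_ (wdist_nonneg S x x)
  have := wdist_le S (g := x) (h := x) [] (by simp) (by simp)
  simpa using this

lemma wdist_tri (hS : Subgroup.closure S = ⊤) (x y z : G) :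
    wdist S x z ≤ wdist S x y + wdist S y z := by
  obtain ⟨l, hl, hp, h1⟩ := wdist_attained hS x y
  obtain ⟨l', hl', hp', h2⟩ := wdist_attained hS y z
  have := wdist_le S (g := x) (h := z) (l ++ l')
    (by intro a ha
        rcases List.mem_append.1 ha with ha | ha
        · exact hl a ha
        · exact hl' a ha)
    (by rw [List.prod_append, hp, hp']; group)
  rw [h1, h2]
  simpa using this

lemma wdist_symm_le (hS : Subgroup.closure S = ⊤) (x y : G) :
    wdist S y x ≤ wdist S x y := by
  obtain ⟨l, hl, hp, h1⟩ := wdist_attained hS x y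
  have := wdist_le S (g := y) (h := x) (l.map (fun a => a⁻¹)).reverse
    (by intro a ha
        rw [List.mem_reverse, List.mem_map] at ha
        obtain ⟨b, hb, rfl⟩ := ha
        rw [inv_inv]
        exact (hl b hb).symm)
    (by rw [← List.prod_inv_reverse, hp]; group)
  rw [h1]
  simpa using this

lemma wdist_symm (hS : Subgroup.closure S = ⊤) (x y : G) : wdist S x y = wdist S y x :=
  le_antisymm (wdist_symm_le hS y x) (wdist_symm_le hS x y)

lemma wdist_geod (hS : Subgroup.closure S = ⊤) (x y : G) :
    ∃ (c : ℕ → G) (m : ℕ), DiscGeodD (wdist S) c m ∧ c 0 = x ∧ c m = y := by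
  obtain ⟨l, hl, hp, h1⟩ := wdist_attained hS x y
  have hle : ∀ i j, i ≤ j → j ≤ l.length →
      wdist S (x * (l.take i).prod) (x * (l.take j).prod) ≤ (j : ℝ) - i := by
    intro i j hij hj
    have hsplit : l.take j = l.take i ++ (l.take j).drop i := by
      conv_lhs => rw [← List.take_append_drop i (l.take j)]
      rw [List.take_take, min_eq_left hij]
    have := wdist_le S (g := x * (l.take i).prod) (h := x * (l.take j).prod) ((l.take j).drop i)
      (fun a ha => hl a (List.mem_of_mem_take (List.mem_of_mem_drop ha)))
      (by rw [hsplit]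
          simp only [List.prod_append]
          rw [← hsplit]; group)
    refine this.trans (le_of_eq ?_)
    rw [List.length_drop, List.length_take, min_eq_left hj, Nat.cast_sub hij]
  have heq : ∀ i j, i ≤ j → j ≤ l.length →
      wdist S (x * (l.take i).prod) (x * (l.take j).prod) = (j : ℝ) - i := by
    intro i j hij hj
    refine le_antisymm (hle i j hij hj) ?_
    have a1 := hle 0 i (Nat.zero_le _) (hij.trans hj)
    have a2 := hle j l.length hj le_rfl
    have t1 := wdist_tri hS (x * (l.take 0).prod) (x * (l.take i).prod)
      (x * (l.take l.length).prod)
    have t2 := wdist_tri hS (x * (l.take i).prod) (x * (l.take j).prod)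
      (x * (l.take l.length).prod)
    have e : wdist S (x * (l.take 0).prod) (x * (l.take l.length).prod) = l.length := by
      rw [List.take_length, hp, ← h1]; simp
    push_cast at a1
    linarith
  refine ⟨fun i => x * (l.take i).prod, l.length, ?_, by simp, by simp [hp]⟩
  intro i hi j hj
  rcases le_total i j with hij | hij
  · have : (i : ℝ) ≤ j := by exact_mod_cast hij
    rw [heq i j hij hj, abs_sub_comm, abs_of_nonneg (by linarith)]
  · have : (j : ℝ) ≤ i := by exact_mod_cast hij
    rw [wdist_symm hS, heq j i hij hi, abs_of_nonneg (by linarith)]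

lemma wdist_HM (hS : Subgroup.closure S = ⊤) {δ : ℝ} (hδ : DeltaHypD (wdist S) δ) :
    HM (wdist S) δ :=
  ⟨wdist_self S, wdist_symm hS, wdist_tri hS, wdist_nonneg S, hδ, wdist_geod hS⟩

lemma words_finite (hfin : S.Finite) (n : ℕ) :
    {g : G | ∃ l : List G, (∀ x ∈ l, x ∈ S ∨ x⁻¹ ∈ S) ∧ l.prod = g ∧ l.length = n}.Finite := by
  induction n with
  | zero =>
    refine (Set.finite_singleton (1 : G)).subset ?_
    rintro g ⟨l, -, rfl, hl⟩
    rw [List.length_eq_zero_iff.1 hl]; simp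
  | succ n ih =>
    have hT : {x : G | x ∈ S ∨ x⁻¹ ∈ S}.Finite := by
      refine (hfin.union (hfin.image (fun x => x⁻¹))).subset ?_
      rintro x (hx | hx)
      · exact Or.inl hx
      · exact Or.inr ⟨_, hx, by simp⟩
    refine (Set.Finite.image2 (fun a b => a * b) hT ih).subset ?_
    rintro g ⟨l, hl, rfl, hn⟩
    cases l with
    | nil => simp at hn
    | cons a t =>
      refine ⟨a, hl a (by simp), t.prod, ⟨t, fun x hx => hl x (by simp [hx]), rfl, ?_⟩, by simp⟩
      simpa using hn

lemma balls_finite (hfin : S.Finite) (hS : Subgroup.closure S = ⊤) (r : ℝ) :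
    {x : G | wdist S 1 x ≤ r}.Finite := by
  refine (Set.Finite.biUnion (Set.finite_Iic ⌊r⌋₊) (fun n _ => words_finite hfin n)).subset ?_
  intro x hx
  obtain ⟨l, hl, hp, h1⟩ := wdist_attained hS 1 x
  simp only [Set.mem_setOf_eq] at hx
  rw [h1] at hx
  simp only [Set.mem_iUnion]
  exact ⟨l.length, Nat.le_floor hx, l, hl, by simpa using hp, rfl⟩

lemma cosetSet_eq {H : Subgroup G} {g a : G} (ha : a ∈ cosetSet H g) :
    cosetSet H g = cosetSet H a := by
  ext x
  unfold cosetSet at *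
  simp only [Set.mem_setOf_eq] at *
  have : g⁻¹ * x = (g⁻¹ * a) * (a⁻¹ * x) := by group
  rw [this, H.mul_mem_cancel_left ha]

lemma mem_cosetSet_mul {H : Subgroup G} {g a : G} (p : G) (ha : a ∈ cosetSet H g) :
    p * a ∈ cosetSet H (p * g) := by
  unfold cosetSet at *
  simp only [Set.mem_setOf_eq] at *
  have : (p * g)⁻¹ * (p * a) = g⁻¹ * a := by group
  rwa [this]

lemma gqc_coset {H : Subgroup G} {σ : ℝ} (hH : GQC (wdist S) σ (H : Set G)) (g : G) :
    GQC (wdist S) σ (cosetSet H g) := by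
  intro x hx y hy w
  obtain ⟨a, ha, h1⟩ := hH (g⁻¹ * x) hx (g⁻¹ * y) hy (g⁻¹ * w)
  refine ⟨g * a, by simpa [cosetSet] using ha, ?_⟩
  unfold gpD at *
  simp only [wdist_mul] at h1
  have : wdist S w (g * a) = wdist S (g⁻¹ * w) a := by
    rw [← wdist_mul S g⁻¹ w (g * a)]; simp
  rw [this]; exact h1

lemma asy_mul {δ : ℝ} (h : HM (wdist S) δ) (p : G) {s t : ℕ → G} (hs : Asy (wdist S) 1 s t) :
    Asy (wdist S) 1 (fun n => p * s n) (fun n => p * t n) := by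
  have h1 := (asy_iff _ _ _ _).1 (h.asy_base p⁻¹ hs)
  rw [asy_iff]
  intro M
  obtain ⟨N, hN⟩ := h1 M
  refine ⟨N, fun n hn m hm => (hN n hn m hm).trans (le_of_eq ?_)⟩
  unfold gpD
  have e : ∀ x, wdist S 1 (p * x) = wdist S p⁻¹ x := by
    intro x
    rw [← wdist_mul S p⁻¹ 1 (p * x)]; simp
  rw [e, e, wdist_mul]

lemma endIn_mul {δ : ℝ} (h : HM (wdist S) δ) {H : Subgroup G} (p : G) {c : ℕ → G} {a b : G}
    (hc : EndIn (wdist S) 1 c (cosetSet H a) (cosetSet H b)) :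
    EndIn (wdist S) 1 (fun n => p * c n) (cosetSet H (p * a)) (cosetSet H (p * b)) := by
  obtain ⟨h0, ⟨s, hsA, hs, hsc⟩, ⟨t, htA, ht, htc⟩⟩ := hc
  exact ⟨asy_mul h p h0,
    ⟨fun n => p * s n, fun n => mem_cosetSet_mul p (hsA n), asy_mul h p hs, asy_mul h p hsc⟩,
    ⟨fun n => p * t n, fun n => mem_cosetSet_mul p (htA n), asy_mul h p ht, asy_mul h p htc⟩⟩

lemma inter_mul {δ : ℝ} (h : HM (wdist S) δ) {H : Subgroup G} (p : G) {a b : G}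
    (hne : (cosetLimitSet S H a ∩ cosetLimitSet S H b).Nonempty) :
    (cosetLimitSet S H (p * a) ∩ cosetLimitSet S H (p * b)).Nonempty := by
  unfold cosetLimitSet at *
  rw [h.inter_nonempty_iff] at *
  obtain ⟨c, hc⟩ := hne
  exact ⟨_, endIn_mul h p hc⟩

lemma join_mul {δ : ℝ} (h : HM (wdist S) δ) {H : Subgroup G} (p : G) {a b z : G}
    (hz : z ∈ joinD (wdist S) 1 (cosetLimitSet S H a ∩ cosetLimitSet S H b)) :
    p * z ∈ joinD (wdist S) 1 (cosetLimitSet S H (p * a) ∩ cosetLimitSet S H (p * b)) := by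
  unfold cosetLimitSet at *
  rw [h.mem_join_iff] at *
  obtain ⟨γ, hγ, ⟨h1, h2⟩, k, rfl⟩ := hz
  refine ⟨fun n => p * γ n, fun i j => ?_, ⟨endIn_mul h p h1, endIn_mul h p h2⟩, k, rfl⟩
  rw [wdist_mul]; exact hγ i j

lemma cosetJoin_mul {δ : ℝ} (h : HM (wdist S) δ) {H : Subgroup G} (p : G) {a z : G}
    (hz : z ∈ cosetJoin S H a) : p * z ∈ cosetJoin S H (p * a) := by
  unfold cosetJoin at *
  rw [← Set.inter_self (cosetLimitSet S H _)] at *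
  exact join_mul h p hz

end wordMetric

/-- **Proposition (cobdd).** Let `H` be a quasiconvex subgroup of a hyperbolic
group `G` with limit set `Λ`, `L_k = g_kΛ` the translates of the limit set and
`P_j` a nearest point projection of `Γ_G` onto the join `J(L_j)`.  There exists
`K > 0` such that for all essentially distinct `g_i, g_j`: if `L_i ∩ L_j ≠ ∅`,
the image `P_j(Γ_{H_i})` of the coset `g_iH` lies in the `K`-neighbourhood of
`J(L_i ∩ L_j)`; otherwise `P_j(Γ_{H_i})` has diameter less than `K`. -/
theorem nearest_point_projection_of_coset_onto_join
    {G : Type*} [Group G] (S : Set G) (hSfin : S.Finite)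
    (hSgen : Subgroup.closure S = ⊤) (hhyp : HypD (wdist S))
    (H : Subgroup G) (hqc : QCSubgroup S H) :
    ∃ K > (0 : ℝ), ∀ gi gj : G, gi⁻¹ * gj ∉ H →
      ∀ P : G → G, IsNearestProjD (wdist S) (cosetJoin S H gj) P →
        ((cosetLimitSet S H gi ∩ cosetLimitSet S H gj).Nonempty →
          ∀ x ∈ cosetSet H gi,
            pdistD (wdist S) (P x)
              (joinD (wdist S) 1 (cosetLimitSet S H gi ∩ cosetLimitSet S H gj)) ≤ K) ∧
        (cosetLimitSet S H gi ∩ cosetLimitSet S H gj = ∅ →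
          ∀ x ∈ cosetSet H gi, ∀ y ∈ cosetSet H gi, wdist S (P x) (P y) < K) := by
  obtain ⟨δ, hδ0, hδ⟩ := hhyp
  obtain ⟨C, hC0, hC⟩ := hqc
  have h := wdist_HM hSgen hδ
  have hfin := balls_finite hSfin hSgen
  by_cases hJ0 : ∃ z0, z0 ∈ cosetJoin S H 1
  swap
  · refine ⟨1, one_pos, fun gi gj _ P hP => ?_⟩
    exfalso
    apply hJ0
    have := cosetJoin_mul h gj⁻¹ (hP 1).1
    rw [inv_mul_cancel] at this
    exact ⟨_, this⟩
  obtain ⟨z0, hz0⟩ := hJ0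
  set σ := C + 2 * δ + 2 with hσ
  have hσ0 : 0 ≤ σ := by positivity
  have hQ : ∀ g, GQC (wdist S) σ (cosetSet H g) := gqc_coset (h.gqc hC)
  set R0 := max (2 * δ + σ) (wdist S 1 z0) with hR0
  have hR00 : 0 ≤ R0 := le_trans (by positivity) (le_max_left _ _)
  have hJB : ∀ g, ∀ z ∈ cosetJoin S H g, ∃ a ∈ cosetSet H g, wdist S z a ≤ R0 := by
    intro g z hz
    obtain ⟨a, ha, h1⟩ := h.join_close (hQ g) z hz
    exact ⟨a, ha, h1.trans (le_max_left _ _)⟩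
  have hBJ : ∀ g, ∀ a ∈ cosetSet H g, ∃ z ∈ cosetJoin S H g, wdist S a z ≤ R0 := by
    intro g a ha
    refine ⟨a * z0, ?_, ?_⟩
    · have h1 := cosetJoin_mul h a hz0
      rw [mul_one] at h1
      unfold cosetJoin cosetLimitSet at *
      rw [cosetSet_eq ha]; exact h1
    · have := wdist_mul S a 1 z0
      rw [mul_one] at this
      rw [this]; exact le_max_right _ _
  set τ := σ + 3 * R0 with hτ
  have hτ0 : 0 ≤ τ := by positivity
  have hQJ : ∀ g, GQC (wdist S) τ (cosetJoin S H g) := fun g =>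
    h.gqc_close (hQ g) (hJB g) (hBJ g)
  set R := 2 * δ + τ + 1 + σ with hR
  have hR0R : R0 ≤ R := by rw [hR, hτ]; linarith
  set D := 2 * (δ + τ + 1) + δ with hD
  have hD0 : 0 ≤ D := by positivity
  -- constants for pairs of cosets close to the identity
  have hpair : ∀ q : G × G, ∃ K : ℝ,
      ((joinD (wdist S) 1 (cosetLimitSet S H q.1 ∩ cosetLimitSet S H q.2)).Nonempty →
        ∃ z ∈ joinD (wdist S) 1 (cosetLimitSet S H q.1 ∩ cosetLimitSet S H q.2),
          wdist S 1 z ≤ K) ∧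
      (cosetLimitSet S H q.1 ∩ cosetLimitSet S H q.2 = ∅ →
        ∀ z, (∃ a ∈ cosetSet H q.1, wdist S z a ≤ R) →
          (∃ b ∈ cosetSet H q.2, wdist S z b ≤ R) → wdist S 1 z ≤ K) := by
    rintro ⟨u', v'⟩
    have e1 : ∃ K1 : ℝ,
        (joinD (wdist S) 1 (cosetLimitSet S H u' ∩ cosetLimitSet S H v')).Nonempty →
        ∃ z ∈ joinD (wdist S) 1 (cosetLimitSet S H u' ∩ cosetLimitSet S H v'),
          wdist S 1 z ≤ K1 := by
      by_cases hne : (joinD (wdist S) 1 (cosetLimitSet S H u' ∩ cosetLimitSet S H v')).Nonempty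
      · obtain ⟨z, hz⟩ := hne
        exact ⟨wdist S 1 z, fun _ => ⟨z, hz, le_rfl⟩⟩
      · exact ⟨0, fun hh => absurd hh hne⟩
    have e2 : ∃ K2 : ℝ, cosetLimitSet S H u' ∩ cosetLimitSet S H v' = ∅ →
        ∀ z, (∃ a ∈ cosetSet H u', wdist S z a ≤ R) →
          (∃ b ∈ cosetSet H v', wdist S z b ≤ R) → wdist S 1 z ≤ K2 := by
      by_cases he : cosetLimitSet S H u' ∩ cosetLimitSet S H v' = ∅
      · have hf : {x | (∃ a ∈ cosetSet H u', wdist S x a ≤ R) ∧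
            ∃ b ∈ cosetSet H v', wdist S x b ≤ R}.Finite := by
          by_contra hinf
          have := h.inter_of_infinite 1 hfin hinf
          unfold cosetLimitSet at he
          rw [he] at this
          exact Set.not_nonempty_empty this
        obtain ⟨K2, hK2⟩ := (hf.image (wdist S 1)).bddAbove
        exact ⟨K2, fun _ z h1 h2 => hK2 ⟨z, ⟨h1, h2⟩, rfl⟩⟩
      · exact ⟨0, fun hh => absurd hh he⟩
    obtain ⟨K1, hK1⟩ := e1
    obtain ⟨K2, hK2⟩ := e2
    refine ⟨max K1 K2, fun hne => ?_, fun he z h1 h2 => (hK2 he z h1 h2).trans (le_max_right _ _)⟩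
    obtain ⟨z, hz, h1⟩ := hK1 hne
    exact ⟨z, hz, h1.trans (le_max_left _ _)⟩
  choose κ hκ1 hκ2 using hpair
  obtain ⟨K0, hK0⟩ := (((hfin R).prod (hfin R)).image κ).bddAbove
  refine ⟨max K0 D + 1, by have := le_max_right K0 D; linarith, ?_⟩
  intro gi gj _ P hP
  have near1 : ∀ x, ∀ a ∈ cosetSet H gi, wdist S (P x) a ≤ R →
      ∃ b ∈ cosetSet H gj, wdist S (P x) b ≤ R ∧ κ ((P x)⁻¹ * a, (P x)⁻¹ * b) ≤ K0 := by
    intro x a ha h1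
    obtain ⟨b, hb, h2⟩ := hJB gj (P x) (hP x).1
    refine ⟨b, hb, h2.trans hR0R, hK0 ⟨_, ⟨?_, ?_⟩, rfl⟩⟩
    · have := wdist_mul S (P x)⁻¹ (P x) a
      rw [inv_mul_cancel] at this
      simp only [Set.mem_setOf_eq]
      rw [this]; exact h1
    · have := wdist_mul S (P x)⁻¹ (P x) b
      rw [inv_mul_cancel] at this
      simp only [Set.mem_setOf_eq]
      rw [this]; exact h2.trans hR0R
  have hlim : ∀ g, ∀ a ∈ cosetSet H g, cosetLimitSet S H g = cosetLimitSet S H a := by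
    intro g a ha
    unfold cosetLimitSet
    rw [cosetSet_eq ha]
  constructor
  · intro hne x hx
    by_cases hjn : (joinD (wdist S) 1 (cosetLimitSet S H gi ∩ cosetLimitSet S H gj)).Nonempty
    swap
    · rw [Set.not_nonempty_iff_eq_empty] at hjn
      rw [hjn]
      have : pdistD (wdist S) (P x) ∅ = 0 := by simp [pdistD]
      rw [this]
      have := le_max_right K0 D; linarith
    obtain ⟨y, hy, hxy⟩ := h.proj_unbdd (hQJ gj) (hBJ gj) hP hne (P x) D
    obtain ⟨a, ha, h1⟩ := h.proj_near hδ0 hτ0 (hQ gi) (hQJ gj) hP hx hy hxy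
    obtain ⟨b, hb, h2, h3⟩ := near1 x a ha h1
    rw [hlim gi a ha, hlim gj b hb] at hjn ⊢
    obtain ⟨z, hz⟩ := hjn
    obtain ⟨z', hz', h4⟩ := hκ1 ((P x)⁻¹ * a, (P x)⁻¹ * b) ⟨_, join_mul h (P x)⁻¹ hz⟩
    have h5 := join_mul h (P x) hz'
    simp only [mul_inv_cancel_left] at h5
    have h6 : wdist S (P x) (P x * z') ≤ K0 := by
      have := wdist_mul S (P x) 1 z'
      rw [mul_one] at this
      rw [this]; exact h4.trans h3
    have h7 : pdistD (wdist S) (P x)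
        (joinD (wdist S) 1 (cosetLimitSet S H a ∩ cosetLimitSet S H b)) ≤ K0 := by
      refine le_trans (csInf_le ⟨0, ?_⟩ ⟨_, h5, rfl⟩) h6
      rintro r ⟨a, -, rfl⟩
      exact wdist_nonneg S _ _
    have := le_max_left K0 D
    linarith
  · intro he x hx y hy
    rcases le_or_gt (wdist S (P x) (P y)) D with hxy | hxy
    · have := le_max_right K0 D; linarith
    obtain ⟨a, ha, h1⟩ := h.proj_near hδ0 hτ0 (hQ gi) (hQJ gj) hP hx hy hxy
    obtain ⟨b, hb, h2, h3⟩ := near1 x a ha h1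
    rw [wdist_symm hSgen] at hxy
    obtain ⟨a', ha', h1'⟩ := h.proj_near hδ0 hτ0 (hQ gi) (hQJ gj) hP hy hx hxy
    obtain ⟨b', hb', h2', -⟩ := near1 y a' ha' h1'
    rw [hlim gi a ha, hlim gj b hb] at he
    rw [cosetSet_eq ha] at ha'
    rw [cosetSet_eq hb] at hb'
    have he' : cosetLimitSet S H ((P x)⁻¹ * a) ∩ cosetLimitSet S H ((P x)⁻¹ * b) = ∅ := by
      by_contra hcon
      have := inter_mul h (P x) (Set.nonempty_iff_ne_empty.2 hcon)
      simp only [mul_inv_cancel_left] at this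
      rw [he] at this
      exact Set.not_nonempty_empty this
    have h4 := hκ2 ((P x)⁻¹ * a, (P x)⁻¹ * b) he' ((P x)⁻¹ * P y)
      ⟨_, mem_cosetSet_mul (P x)⁻¹ ha', by rw [wdist_mul]; exact h1'⟩
      ⟨_, mem_cosetSet_mul (P x)⁻¹ hb', by rw [wdist_mul]; exact h2'⟩
    have h5 : wdist S (P x) (P y) = wdist S 1 ((P x)⁻¹ * P y) := by
      rw [← wdist_mul S (P x)⁻¹ (P x) (P y), inv_mul_cancel]
    have := le_max_left K0 D
    rw [h5]
    linarith

end RelRig
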